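/- Let ψ ∈ C²(R^d) and θ ∈ C²_c(D,R^d) with flow T_s. Then the map s ↦ [D²(ψ∘T_s^{-1})]∘T_s is differentiable at s=0 with derivative −Dθᵀ D²ψ − D²ψ Dθ − D²θᵀ ∇ψ; consequently s ↦ [Δ(ψ∘T_s^{-1})]∘T_s is differentiable at s=0 with derivative −2 D²ψ : Dθ − (Δθ)·∇ψ. -/

import Mathlib

open Set

/-- Second partial derivative `∂_j∂_k f` of a scalar function on `ℝ^d`. -/
noncomputable def hess {d : ℕ} (f : (Fin d → ℝ) → ℝ) (x : Fin d → ℝ) (j k : Fin d) : ℝ :=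
  fderiv ℝ (fun y => fderiv ℝ f y (Pi.single k 1)) x (Pi.single j 1)

open scoped Topology unitInterval

universe u

/-- Pointwise application of a continuous family of operators to a continuous family of vectors. -/
noncomputable def pointwiseApply {K E F : Type*} [TopologicalSpace K] [CompactSpace K]
    [NormedAddCommGroup E] [NormedSpace ℝ E] [NormedAddCommGroup F] [NormedSpace ℝ F] :
    C(K, E →L[ℝ] F) →L[ℝ] C(K, E) →L[ℝ] C(K, F) :=
  LinearMap.mkContinuous₂
    (LinearMap.mk₂ ℝ
      (fun (A : C(K, E →L[ℝ] F)) (h : C(K, E)) => (⟨fun t => A t (h t), by fun_prop⟩ : C(K, F)))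
      (fun _ _ _ => rfl) (fun _ _ _ => rfl)
      (fun A h k => by ext t; exact map_add (A t) (h t) (k t))
      (fun c A h => by ext t; exact map_smul (A t) c (h t)))
    1 fun A h => by
      rw [one_mul, ContinuousMap.norm_le _ (by positivity)]
      exact fun t => ((A t).le_opNorm (h t)).trans
        (mul_le_mul (A.norm_coe_le_norm t) (h.norm_coe_le_norm t) (by positivity) (by positivity))

/-- Post-composition with a `C¹` map is differentiable on a space of continuous functions. -/
theorem hasFDerivAt_postcomp {K E F : Type*} [TopologicalSpace K] [CompactSpace K]
    [NormedAddCommGroup E] [NormedSpace ℝ E] [NormedAddCommGroup F] [NormedSpace ℝ F]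
    (f : C(E, F)) (f' : C(E, E →L[ℝ] F)) (hf : ∀ x, HasFDerivAt f (f' x) x) (γ : C(K, E)) :
    HasFDerivAt (fun γ : C(K, E) => f.comp γ) (pointwiseApply (f'.comp γ)) γ := by
  rw [hasFDerivAt_iff_isLittleO_nhds_zero, Asymptotics.isLittleO_iff]
  intro ε hε
  have hu := (isCompact_range γ.continuous).uniformContinuousAt_of_continuousAt f'
    (fun a _ => f'.continuous.continuousAt) (Metric.dist_mem_uniformity hε)
  obtain ⟨δ, hδ, hsub⟩ := Metric.mem_uniformity_dist.1 hu
  filter_upwards [Metric.ball_mem_nhds (0 : C(K, E)) hδ] with h hh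
  rw [mem_ball_zero_iff] at hh
  rw [ContinuousMap.norm_le _ (by positivity)]
  intro t
  have key := (convex_ball (γ t) δ).norm_image_sub_le_of_norm_hasFDerivWithin_le'
    (f := f) (f' := f') (φ := f' (γ t)) (C := ε) (x := γ t) (y := γ t + h t)
    (fun y _ => (hf y).hasFDerivWithinAt)
    (fun y hy => by
      rw [← dist_eq_norm, dist_comm]
      exact le_of_lt (hsub (by rwa [dist_comm]) (mem_range_self t)))
    (Metric.mem_ball_self hδ)
    (by simpa [dist_eq_norm] using (h.norm_coe_le_norm t).trans_lt hh)
  rw [add_sub_cancel_left] at key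
  exact key.trans (mul_le_mul_of_nonneg_left (h.norm_coe_le_norm t) hε.le)

/-- Post-composition with a `Cⁿ` map is `Cⁿ` on a space of continuous functions. -/
theorem contDiff_postcomp {K : Type*} {E F : Type u} [TopologicalSpace K] [CompactSpace K]
    [NormedAddCommGroup E] [NormedSpace ℝ E] [NormedAddCommGroup F] [NormedSpace ℝ F]
    (n : ℕ) (f : C(E, F)) (hf : ContDiff ℝ n f) :
    ContDiff ℝ n (fun γ : C(K, E) => f.comp γ) := by
  induction n generalizing F with
  | zero => exact contDiff_zero.2 f.continuous_postcomp
  | succ n ih =>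
    rw [Nat.cast_succ, contDiff_succ_iff_hasFDerivAt] at hf ⊢
    obtain ⟨f', hf', hd⟩ := hf
    have hp : ContDiff ℝ n (pointwiseApply : C(K, E →L[ℝ] F) → C(K, E) →L[ℝ] C(K, F)) := by
      fun_prop
    exact ⟨_, hp.comp (ih ⟨f', hf'.continuous⟩ hf'),
      hasFDerivAt_postcomp f ⟨f', hf'.continuous⟩ hd⟩

/-- The primitive vanishing at `0` of a continuous function on the unit interval. -/
noncomputable def unitPrimitive (E : Type*) [NormedAddCommGroup E] [NormedSpace ℝ E] :
    C(I, E) →L[ℝ] C(I, E) :=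
  LinearMap.mkContinuous
    { toFun := fun γ => ⟨fun t => ∫ u in (0 : ℝ)..t, IccExtend zero_le_one γ u,
        (intervalIntegral.continuous_primitive
          (fun a b => γ.continuous.Icc_extend'.intervalIntegrable a b) 0).comp
          continuous_subtype_val⟩
      map_add' := fun γ η => by
        ext t
        exact intervalIntegral.integral_add (γ.continuous.Icc_extend'.intervalIntegrable _ _)
          (η.continuous.Icc_extend'.intervalIntegrable _ _)
      map_smul' := fun c γ => by
        ext t
        exact intervalIntegral.integral_smul c _ }
    1 fun γ => by
      rw [one_mul, ContinuousMap.norm_le _ (by positivity)]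
      intro t
      refine (intervalIntegral.norm_integral_le_of_norm_le_const
        (C := ‖γ‖) fun u _ => γ.norm_coe_le_norm _).trans ?_
      rw [sub_zero, abs_of_nonneg t.2.1]
      exact mul_le_of_le_one_right (norm_nonneg _) t.2.2

theorem unitPrimitive_apply {E : Type*} [NormedAddCommGroup E] [NormedSpace ℝ E]
    (γ : C(I, E)) (t : I) :
    unitPrimitive E γ t = ∫ u in (0 : ℝ)..t, IccExtend zero_le_one γ u := rfl

/-- The flow of a bounded `Cⁿ` field is `T r y = y + r • H (r, y)` with `H` of class `Cⁿ` in
time and space jointly near time `0`. -/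
theorem exists_contDiffAt_flow_increment {E : Type u} [NormedAddCommGroup E] [NormedSpace ℝ E]
    [CompleteSpace E] {n : ℕ} (hn : n ≠ 0) {θ : E → E} (hθ : ContDiff ℝ n θ)
    {M : ℝ} (hM : ∀ x, ‖θ x‖ ≤ M) {T : ℝ → E → E} (hT0 : ∀ x, T 0 x = x)
    (hT : ∀ x s, HasDerivAt (fun t => T t x) (θ (T s x)) s) (x : E) :
    ∃ H : ℝ × E → E, ContDiffAt ℝ n H (0, x) ∧ (∀ r y, T r y = y + r • H (r, y)) ∧
      ∀ y, H (0, y) = θ y := by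
  have hTc : ∀ y, Continuous fun t => T t y := fun y =>
    continuous_iff_continuousAt.2 fun s => (hT y s).continuousAt
  let Θ : C(E, E) := ⟨θ, hθ.continuous⟩
  let Γ : ℝ × E → C(I, E) := fun p =>
    ⟨fun t => T (p.1 * t) p.2, (hTc p.2).comp (by fun_prop)⟩
  have hd : ∀ r y u, HasDerivAt (fun t : ℝ => T (r * t) y) (r • θ (T (r * u) y)) u := by
    intro r y u
    have h := (hasDerivAt_id u).const_mul r
    rw [mul_one] at h
    exact (hT y (r * u)).scomp u h
  have hint : ∀ r y (t : I), r • unitPrimitive E (Θ.comp (Γ (r, y))) t = T (r * t) y - y := by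
    intro r y t
    have h1 := intervalIntegral.integral_eq_sub_of_hasDerivAt (a := 0) (b := (t : ℝ))
      (fun u _ => hd r y u)
      ((((hθ.continuous.comp ((hTc y).comp (continuous_const_mul r))).const_smul
        r)).intervalIntegrable _ _)
    rw [mul_zero, hT0] at h1
    rw [unitPrimitive_apply, ← intervalIntegral.integral_smul, ← h1]
    refine intervalIntegral.integral_congr fun u hu => ?_
    rw [uIcc_of_le t.2.1] at hu
    have hu' : u ∈ Icc (0 : ℝ) 1 := ⟨hu.1, hu.2.trans t.2.2⟩
    simp only [IccExtend_of_mem _ _ hu']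
    rfl
  let Φ : (ℝ × E) × C(I, E) → C(I, E) := fun p =>
    p.2 - ContinuousLinearMap.const ℝ I p.1.2 - p.1.1 • unitPrimitive E (Θ.comp p.2)
  let p₀ : (ℝ × E) × C(I, E) := ((0, x), ContinuousMap.const I x)
  have hΘ : ContDiff ℝ n (fun γ : C(I, E) => Θ.comp γ) := contDiff_postcomp n Θ hθ
  have hΦ : ContDiff ℝ n Φ :=
    (contDiff_snd.sub ((ContinuousLinearMap.const ℝ I).contDiff.comp
      (contDiff_snd.comp contDiff_fst))).sub
      ((contDiff_fst.comp contDiff_fst).smul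
        ((unitPrimitive E).contDiff.comp (hΘ.comp contDiff_snd)))
  have hn' : (n : WithTop ℕ∞) ≠ 0 := by exact_mod_cast hn
  have hinr : fderiv ℝ Φ p₀ ∘L .inr ℝ (ℝ × E) C(I, E) = .id ℝ _ := by
    have h1 : HasFDerivAt (fun γ : C(I, E) => Φ ((0, x), γ))
        (fderiv ℝ Φ p₀ ∘L .inr ℝ (ℝ × E) C(I, E)) (ContinuousMap.const I x) :=
      ((hΦ.differentiable hn').differentiableAt.hasFDerivAt (x := p₀)).comp _
        (hasFDerivAt_prodMk_right (0, x) (ContinuousMap.const I x))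
    have h2 : (fun γ : C(I, E) => Φ ((0, x), γ)) =
        fun γ => γ - ContinuousLinearMap.const ℝ I x := by
      funext γ
      simp [Φ]
    rw [h2] at h1
    exact h1.unique ((hasFDerivAt_id _).sub_const _)
  have hinv : (fderiv ℝ Φ p₀ ∘L .inr ℝ (ℝ × E) C(I, E)).IsInvertible := by
    rw [hinr]
    exact ⟨ContinuousLinearEquiv.refl ℝ _, rfl⟩
  have hΦΓ : ∀ p, Φ (p, Γ p) = 0 := by
    rintro ⟨r, y⟩
    ext t
    change T (r * t) y - y - r • unitPrimitive E (Θ.comp (Γ (r, y))) t = 0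
    rw [hint, sub_self]
  have hΓ₀ : Γ (0, x) = ContinuousMap.const I x := by
    ext t
    change T (0 * t) x = x
    rw [zero_mul, hT0]
  have hbound : ∀ r y, ‖T r y - y‖ ≤ M * |r| := by
    intro r y
    have h := convex_univ.norm_image_sub_le_of_norm_hasDerivWithin_le (f := fun t => T t y)
      (fun s _ => (hT y s).hasDerivWithinAt) (fun s _ => hM _) (mem_univ 0) (mem_univ r)
    simpa [hT0] using h
  have hΓc : Filter.Tendsto Γ (𝓝 (0, x)) (𝓝 (ContinuousMap.const I x)) := by
    rw [tendsto_iff_norm_sub_tendsto_zero]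
    have hz : Filter.Tendsto (fun p : ℝ × E => M * |p.1| + ‖p.2 - x‖) (𝓝 (0, x)) (𝓝 0) := by
      have : Continuous fun p : ℝ × E => M * |p.1| + ‖p.2 - x‖ := by fun_prop
      simpa using this.tendsto (0, x)
    refine squeeze_zero (fun _ => norm_nonneg _) (fun p => ?_) hz
    have hM0 : 0 ≤ M := (norm_nonneg _).trans (hM x)
    rw [ContinuousMap.norm_le _ (by positivity)]
    intro t
    change ‖T (p.1 * t) p.2 - x‖ ≤ _
    rw [← sub_add_sub_cancel _ p.2 x]
    refine (norm_add_le _ _).trans (add_le_add_left ((hbound _ _).trans ?_) _)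
    rw [abs_mul, abs_of_nonneg t.2.1]
    exact mul_le_mul_of_nonneg_left (mul_le_of_le_one_right (abs_nonneg _) t.2.2) hM0
  have hev : ∀ᶠ p in 𝓝 (0, x), hΦ.contDiffAt.implicitFunction hn' hinv p = Γ p := by
    have ht : Filter.Tendsto (fun p => (p, Γ p)) (𝓝 (0, x)) (𝓝 p₀) := by
      rw [nhds_prod_eq (x := ((0 : ℝ), x))]
      exact Filter.tendsto_id.prodMk hΓc
    filter_upwards [ht.eventually
      (hΦ.contDiffAt.eventually_apply_eq_iff_implicitFunction hn' hinv)] with p hp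
    have h0 : Φ p₀ = 0 := by
      have := hΦΓ (0, x)
      rwa [hΓ₀] at this
    exact hp.1 ((hΦΓ p).trans h0.symm)
  have hΓd : ContDiffAt ℝ n Γ (0, x) :=
    (hΦ.contDiffAt.contDiffAt_implicitFunction hn' hinv).congr_of_eventuallyEq
      (hev.mono fun _ h => h.symm)
  refine ⟨fun p => unitPrimitive E (Θ.comp (Γ p)) 1, ?_, fun r y => ?_, fun y => ?_⟩
  · exact ((ContinuousMap.evalCLM ℝ (1 : I)).comp (unitPrimitive E)).contDiff.contDiffAt.comp _
      (hΘ.contDiffAt.comp _ hΓd)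
  · rw [hint]
    simp
  · have h : ∀ u : ℝ, IccExtend zero_le_one (Θ.comp (Γ (0, y))) u = θ y := by
      intro u
      change θ (T (0 * _) y) = θ y
      rw [zero_mul, hT0]
    change unitPrimitive E (Θ.comp (Γ (0, y))) 1 = θ y
    rw [unitPrimitive_apply, funext h]
    simp

theorem hasDerivAt_smul_of_continuousAt {F : Type*} [NormedAddCommGroup F] [NormedSpace ℝ F]
    {P : ℝ → F} (hP : ContinuousAt P 0) : HasDerivAt (fun s => s • P s) (P 0) 0 := by
  rw [hasDerivAt_iff_tendsto_slope]
  refine (hP.tendsto.mono_left nhdsWithin_le_nhds).congr' ?_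
  filter_upwards [self_mem_nhdsWithin] with s hs
  simp [slope_def_module, smul_smul, inv_mul_cancel₀ (show s ≠ 0 from hs)]

/-- Chain rule for second directional derivatives. -/
theorem fderiv_fderiv_comp_apply {E F G : Type*} [NormedAddCommGroup E] [NormedSpace ℝ E]
    [NormedAddCommGroup F] [NormedSpace ℝ F] [NormedAddCommGroup G] [NormedSpace ℝ G]
    {ψ : F → G} {g : E → F} {y : E} (hψ : ContDiff ℝ 2 ψ) (hg : ContDiffAt ℝ 2 g y) (v w : E) :
    fderiv ℝ (fun z => fderiv ℝ (ψ ∘ g) z v) y w =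
      fderiv ℝ (fderiv ℝ ψ) (g y) (fderiv ℝ g y w) (fderiv ℝ g y v) +
        fderiv ℝ ψ (g y) (fderiv ℝ (fun z => fderiv ℝ g z v) y w) := by
  have hev : (fun z => fderiv ℝ (ψ ∘ g) z v) =ᶠ[𝓝 y]
      fun z => fderiv ℝ ψ (g z) (fderiv ℝ g z v) := by
    filter_upwards [hg.eventually (by simp)] with z hz
    rw [fderiv_comp z (hψ.differentiable two_ne_zero _) (hz.differentiableAt two_ne_zero)]
    rfl
  rw [hev.fderiv_eq]
  have h1 : HasFDerivAt (fun z => fderiv ℝ ψ (g z))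
      (fderiv ℝ (fderiv ℝ ψ) (g y) ∘L fderiv ℝ g y) y :=
    (((hψ.fderiv_right (m := 1) le_rfl).differentiable one_ne_zero) (g y)).hasFDerivAt.comp y
      (hg.differentiableAt two_ne_zero).hasFDerivAt
  have h2 : DifferentiableAt ℝ (fun z => fderiv ℝ g z v) y :=
    ((hg.fderiv_right (m := 1) le_rfl).differentiableAt one_ne_zero).clm_apply
      (differentiableAt_const v)
  rw [(h1.clm_apply h2.hasFDerivAt).fderiv]
  simp [add_comm]

theorem fderiv_slice_apply {E F : Type*} [NormedAddCommGroup E] [NormedSpace ℝ E]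
    [NormedAddCommGroup F] [NormedSpace ℝ F] {H : ℝ × E → F} {r : ℝ} {y : E}
    (hH : DifferentiableAt ℝ H (r, y)) (v : E) :
    fderiv ℝ (fun z => H (r, z)) y v = fderiv ℝ H (r, y) (0, v) := by
  have h : HasFDerivAt (fun z => H (r, z)) (fderiv ℝ H (r, y) ∘L .inr ℝ ℝ E) y :=
    hH.hasFDerivAt.comp y (hasFDerivAt_prodMk_right r y)
  rw [h.fderiv]
  rfl

/-- Second directional derivatives of `ψ` composed with a perturbation `z + r • H (r, z)` of the
identity. -/
theorem fderiv_fderiv_comp_add_smul_apply {E G : Type*} [NormedAddCommGroup E] [NormedSpace ℝ E]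
    [NormedAddCommGroup G] [NormedSpace ℝ G] {ψ : E → G} (hψ : ContDiff ℝ 2 ψ)
    {H : ℝ × E → E} {r : ℝ} {y : E} (hH : ContDiffAt ℝ 2 H (r, y)) (v w : E) :
    fderiv ℝ (fun z => fderiv ℝ (ψ ∘ fun z => z + r • H (r, z)) z v) y w =
      fderiv ℝ (fderiv ℝ ψ) (y + r • H (r, y)) (w + r • fderiv ℝ H (r, y) (0, w))
          (v + r • fderiv ℝ H (r, y) (0, v)) +
        fderiv ℝ ψ (y + r • H (r, y))
          (r • fderiv ℝ (fun p => fderiv ℝ H p (0, v)) (r, y) (0, w)) := by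
  have hc : ContinuousAt (fun z => (r, z)) y := by fun_prop
  have hslice : ContDiffAt ℝ 2 (fun z => H (r, z)) y :=
    hH.comp y (contDiffAt_const.prodMk contDiffAt_id)
  have hfd : ∀ z, DifferentiableAt ℝ H (r, z) → ∀ u,
      fderiv ℝ (fun z => z + r • H (r, z)) z u = u + r • fderiv ℝ H (r, z) (0, u) := by
    intro z hz u
    have hz' : DifferentiableAt ℝ (fun z => H (r, z)) z :=
      hz.comp z ((differentiableAt_const r).prodMk differentiableAt_id)
    have h : HasFDerivAt (fun z => z + r • H (r, z))
        (.id ℝ E + r • fderiv ℝ (fun z => H (r, z)) z) z :=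
      (hasFDerivAt_id z).fun_add (hz'.hasFDerivAt.fun_const_smul r)
    rw [h.fderiv, ← fderiv_slice_apply hz]
    rfl
  have hP : DifferentiableAt ℝ (fun p => fderiv ℝ H p (0, v)) (r, y) :=
    ((hH.fderiv_right (m := 1) le_rfl).differentiableAt one_ne_zero).clm_apply
      (differentiableAt_const _)
  have hP' : DifferentiableAt ℝ (fun z => fderiv ℝ H (r, z) (0, v)) y :=
    hP.comp y ((differentiableAt_const r).prodMk differentiableAt_id)
  have hev : (fun z => fderiv ℝ (fun z => z + r • H (r, z)) z v) =ᶠ[𝓝 y]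
      fun z => v + r • fderiv ℝ H (r, z) (0, v) := by
    filter_upwards [hc.eventually (hH.eventually (by simp))] with z hz
    exact hfd z (hz.differentiableAt two_ne_zero) v
  have hg : ContDiffAt ℝ 2 (fun z => z + r • H (r, z)) y :=
    contDiffAt_id.add (hslice.const_smul r)
  rw [fderiv_fderiv_comp_apply hψ hg,
    hfd y (hH.differentiableAt two_ne_zero), hfd y (hH.differentiableAt two_ne_zero),
    hev.fderiv_eq, ← fderiv_slice_apply hP,
    ((hP'.hasFDerivAt.fun_const_smul r).const_add v).fderiv]
  rfl

theorem flow_neg_flow {E : Type*} [NormedAddCommGroup E] [NormedSpace ℝ E] {θ : E → E}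
    {C : NNReal} (hθ : LipschitzWith C θ) {T : ℝ → E → E} (hT0 : ∀ x, T 0 x = x)
    (hT : ∀ x s, HasDerivAt (fun t => T t x) (θ (T s x)) s) (s : ℝ) (x : E) :
    T (-s) (T s x) = x := by
  have h := ODE_solution_unique_univ (v := fun _ => θ) (s := fun _ => univ) (K := C)
    (f := fun u => T u (T s x)) (g := fun u => T (u + s) x) (t₀ := 0)
    (fun _ => hθ.lipschitzOnWith) (fun u => ⟨hT _ u, mem_univ _⟩)
    (fun u => ⟨(hT x (u + s)).comp_add_const u s, mem_univ _⟩) (by simp [hT0])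
  simpa [hT0] using congrFun h (-s)

/-- Derivative at time `0` of the second directional derivatives of `ψ` transported by a flow. -/
theorem hasDerivAt_fderiv_fderiv_comp_flow {E : Type u} {G : Type*} [NormedAddCommGroup E]
    [NormedSpace ℝ E] [CompleteSpace E] [NormedAddCommGroup G] [NormedSpace ℝ G]
    {ψ : E → G} (hψ : ContDiff ℝ 2 ψ) {θ : E → E} (hθ : ContDiff ℝ 2 θ)
    {M : ℝ} (hM : ∀ x, ‖θ x‖ ≤ M) {C : NNReal} (hC : LipschitzWith C θ)
    {T : ℝ → E → E} (hT0 : ∀ x, T 0 x = x)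
    (hT : ∀ x s, HasDerivAt (fun t => T t x) (θ (T s x)) s) (x v w : E) :
    HasDerivAt (fun s => fderiv ℝ (fun z => fderiv ℝ (ψ ∘ T (-s)) z v) (T s x) w)
      (-fderiv ℝ (fderiv ℝ ψ) x (fderiv ℝ θ x w) v - fderiv ℝ (fderiv ℝ ψ) x w (fderiv ℝ θ x v)
        - fderiv ℝ ψ x (fderiv ℝ (fun y => fderiv ℝ θ y v) x w)) 0 := by
  obtain ⟨H, hH, hTH, hH0⟩ := exists_contDiffAt_flow_increment two_ne_zero hθ hM hT0 hT x
  rw [Nat.cast_ofNat] at hH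
  let q : ℝ → ℝ × E := fun s => (-s, T s x)
  have hq0 : q 0 = (0, x) := by simp [q, hT0]
  have hq : ContinuousAt q 0 := continuousAt_neg.prodMk (hT x 0).continuousAt
  have hDH : ∀ u, ContDiffAt ℝ 1 (fun p => fderiv ℝ H p (0, u)) (0, x) := fun u =>
    (hH.fderiv_right le_rfl).clm_apply contDiffAt_const
  have hθx : ∀ y u, DifferentiableAt ℝ H (0, y) → fderiv ℝ H (0, y) (0, u) = fderiv ℝ θ y u := by
    intro y u hy
    rw [← fderiv_slice_apply hy, funext hH0]
  have hP : ∀ u, HasDerivAt (fun s => s • fderiv ℝ H (q s) (0, u)) (fderiv ℝ θ x u) 0 := by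
    intro u
    have h := hasDerivAt_smul_of_continuousAt (P := fun s => fderiv ℝ H (q s) (0, u))
      (ContinuousAt.comp' (by rw [hq0]; exact (hDH u).continuousAt) hq)
    rwa [hq0, hθx x u (hH.differentiableAt two_ne_zero)] at h
  have hQ : HasDerivAt (fun s => s • fderiv ℝ (fun p => fderiv ℝ H p (0, v)) (q s) (0, w))
      (fderiv ℝ (fun y => fderiv ℝ θ y v) x w) 0 := by
    have h := hasDerivAt_smul_of_continuousAt
      (P := fun s => fderiv ℝ (fun p => fderiv ℝ H p (0, v)) (q s) (0, w))
      ((ContinuousAt.comp' (f := q) (by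
        rw [hq0]
        exact ((hDH v).fderiv_right (m := 0) le_rfl).continuousAt) hq).clm_apply
          continuousAt_const)
    have hc : ContinuousAt (fun y : E => ((0 : ℝ), y)) x := by fun_prop
    have hev : (fun y => fderiv ℝ H (0, y) (0, v)) =ᶠ[𝓝 x] fun y => fderiv ℝ θ y v := by
      filter_upwards [hc.eventually (hH.eventually (by simp))] with y hy
      exact hθx y v (hy.differentiableAt two_ne_zero)
    rwa [hq0, ← fderiv_slice_apply ((hDH v).differentiableAt one_ne_zero), hev.fderiv_eq] at h
  have hmain : HasDerivAt (fun s => fderiv ℝ (fderiv ℝ ψ) x (w - s • fderiv ℝ H (q s) (0, w))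
        (v - s • fderiv ℝ H (q s) (0, v)) -
      fderiv ℝ ψ x (s • fderiv ℝ (fun p => fderiv ℝ H p (0, v)) (q s) (0, w)))
      (-fderiv ℝ (fderiv ℝ ψ) x (fderiv ℝ θ x w) v - fderiv ℝ (fderiv ℝ ψ) x w (fderiv ℝ θ x v)
        - fderiv ℝ ψ x (fderiv ℝ (fun y => fderiv ℝ θ y v) x w)) 0 := by
    have hB := ((fderiv ℝ (fderiv ℝ ψ) x).hasFDerivAt.comp_hasDerivAt (0 : ℝ)
      ((hP w).const_sub w)).clm_apply ((hP v).const_sub v)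
    refine (hB.sub ((fderiv ℝ ψ x).hasFDerivAt.comp_hasDerivAt (0 : ℝ) hQ)).congr_deriv ?_
    simp [sub_eq_add_neg]
  refine hmain.congr_of_eventuallyEq ?_
  filter_upwards [hq.eventually (by rw [hq0]; exact hH.eventually (by simp))] with s hs
  have hTs : T (-s) = fun z => z + (-s) • H (-s, z) := funext (hTH (-s))
  have hx : T s x + (-s) • H (-s, T s x) = x := by
    rw [← hTH, flow_neg_flow hC hT0 hT]
  rw [hTs, fderiv_fderiv_comp_add_smul_apply hψ hs, hx]
  simp only [q, neg_smul, map_neg, sub_eq_add_neg]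

theorem hess_eq_fderiv_fderiv {d : ℕ} {ψ : (Fin d → ℝ) → ℝ} (hψ : ContDiff ℝ 2 ψ)
    (x : Fin d → ℝ) (j k : Fin d) :
    hess ψ x j k = fderiv ℝ (fderiv ℝ ψ) x (Pi.single j 1) (Pi.single k 1) := by
  have h : DifferentiableAt ℝ (fderiv ℝ ψ) x :=
    (hψ.fderiv_right (m := 1) le_rfl).differentiable one_ne_zero x
  rw [hess, fderiv_clm_apply h (differentiableAt_const _)]
  simp

theorem hess_comm {d : ℕ} {ψ : (Fin d → ℝ) → ℝ} (hψ : ContDiff ℝ 2 ψ)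
    (x : Fin d → ℝ) (j k : Fin d) : hess ψ x j k = hess ψ x k j := by
  rw [hess_eq_fderiv_fderiv hψ, hess_eq_fderiv_fderiv hψ]
  exact (hψ.contDiffAt.isSymmSndFDerivAt (by simp)).eq _ _

theorem clm_apply_eq_sum_single {d : ℕ} {G : Type*} [NormedAddCommGroup G] [NormedSpace ℝ G]
    (L : (Fin d → ℝ) →L[ℝ] G) (u : Fin d → ℝ) : L u = ∑ a, u a • L (Pi.single a 1) := by
  conv_lhs => rw [pi_eq_sum_univ' u]
  simp [map_sum, map_smul]

/-- For `ψ ∈ C²(ℝ^d)` and `θ ∈ C²_c(D,ℝ^d)` with flow `T_s`, the map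
`s ↦ [D²(ψ∘T_s⁻¹)]∘T_s` is differentiable at `s=0` with derivative
`−Dθᵀ D²ψ − D²ψ Dθ − D²θᵀ∇ψ`; consequently `s ↦ [Δ(ψ∘T_s⁻¹)]∘T_s` is
differentiable at `s=0` with derivative `−2 D²ψ : Dθ − (Δθ)·∇ψ`. -/
theorem pullback_hessian_deriv (d : ℕ) (D : Set (Fin d → ℝ))
    (hD : IsOpen D) (hDb : Bornology.IsBounded D)
    (ψ : (Fin d → ℝ) → ℝ) (hψ : ContDiff ℝ 2 ψ)
    (θ : (Fin d → ℝ) → (Fin d → ℝ)) (hθ : ContDiff ℝ 2 θ)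
    (hsupp : HasCompactSupport θ) (hsuppD : tsupport θ ⊆ D)
    (T Tinv : ℝ → (Fin d → ℝ) → (Fin d → ℝ))
    (hT0 : ∀ x₀, T 0 x₀ = x₀)
    (hTode : ∀ x₀ s, HasDerivAt (fun t => T t x₀) (θ (T s x₀)) s)
    (hTinv : ∀ s, Tinv s ∘ T s = id ∧ T s ∘ Tinv s = id) :
    ∀ x : Fin d → ℝ,
      (∀ j k : Fin d,
        HasDerivAt (fun s => hess (ψ ∘ Tinv s) (T s x) j k)
          (-(∑ a, fderiv ℝ θ x (Pi.single j 1) a * hess ψ x a k)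
            - (∑ a, hess ψ x j a * fderiv ℝ θ x (Pi.single k 1) a)
            - ∑ a, fderiv ℝ (fun y => fderiv ℝ θ y (Pi.single k 1) a) x (Pi.single j 1)
                * fderiv ℝ ψ x (Pi.single a 1)) 0) ∧
      HasDerivAt (fun s => ∑ j, hess (ψ ∘ Tinv s) (T s x) j j)
        (-2 * (∑ i, ∑ j, hess ψ x i j * fderiv ℝ θ x (Pi.single j 1) i)
          - ∑ k, (∑ i, fderiv ℝ (fun y => fderiv ℝ θ y (Pi.single i 1) k) x (Pi.single i 1))
              * fderiv ℝ ψ x (Pi.single k 1)) 0 := by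
  obtain ⟨C, hC⟩ := hθ.lipschitzWith_of_hasCompactSupport hsupp two_ne_zero
  obtain ⟨M, hM⟩ := hsupp.exists_bound_of_continuous hθ.continuous
  have hTi : ∀ s, Tinv s = T (-s) := by
    intro s
    funext y
    have hy : T s (Tinv s y) = y := congrFun (hTinv s).2 y
    conv_rhs => rw [← hy, flow_neg_flow hC hT0 hTode]
  intro x
  have hjk : ∀ j k : Fin d,
      HasDerivAt (fun s => hess (ψ ∘ Tinv s) (T s x) j k)
        (-(∑ a, fderiv ℝ θ x (Pi.single j 1) a * hess ψ x a k)
          - (∑ a, hess ψ x j a * fderiv ℝ θ x (Pi.single k 1) a)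
          - ∑ a, fderiv ℝ (fun y => fderiv ℝ θ y (Pi.single k 1) a) x (Pi.single j 1)
              * fderiv ℝ ψ x (Pi.single a 1)) 0 := by
    intro j k
    have hD2θ : DifferentiableAt ℝ (fun y => fderiv ℝ θ y (Pi.single k 1)) x :=
      ((hθ.fderiv_right (m := 1) le_rfl).differentiable one_ne_zero x).clm_apply
        (differentiableAt_const _)
    have h := hasDerivAt_fderiv_fderiv_comp_flow hψ hθ hM hC hT0 hTode x
      (Pi.single k 1) (Pi.single j 1)
    simp only [hTi]
    refine h.congr_deriv ?_
    rw [clm_apply_eq_sum_single (fderiv ℝ (fderiv ℝ ψ) x) (fderiv ℝ θ x (Pi.single j 1)),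
      clm_apply_eq_sum_single _ (fderiv ℝ θ x (Pi.single k 1)),
      clm_apply_eq_sum_single (fderiv ℝ ψ x)]
    simp only [hess_eq_fderiv_fderiv hψ, sum_apply, smul_apply, smul_eq_mul]
    congr 1
    · congr 1
      exact Finset.sum_congr rfl fun a _ => mul_comm _ _
    · refine Finset.sum_congr rfl fun a _ => ?_
      rw [fderiv_apply hD2θ]
      rfl
  refine ⟨hjk, (HasDerivAt.fun_sum fun j _ => hjk j j).congr_deriv ?_⟩
  simp only [Finset.sum_sub_distrib, Finset.sum_neg_distrib]
  congr 1
  · have h1 : ∑ j, ∑ a, fderiv ℝ θ x (Pi.single j 1) a * hess ψ x a j =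
        ∑ i, ∑ j, hess ψ x i j * fderiv ℝ θ x (Pi.single j 1) i := by
      rw [Finset.sum_comm]
      simp only [mul_comm]
    have h2 : ∑ j, ∑ a, hess ψ x j a * fderiv ℝ θ x (Pi.single j 1) a =
        ∑ i, ∑ j, hess ψ x i j * fderiv ℝ θ x (Pi.single j 1) i := by
      rw [Finset.sum_comm]
      simp only [fun j a => hess_comm hψ x j a]
    rw [h1, h2]
    ring
  · rw [Finset.sum_comm]
    simp only [Finset.sum_mul]
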